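/- If M is an ω-stable, model-complete, homogenizable structure over a finite relational vocabulary, then M is boundedly homogenizable. -/

import Mathlib

open FirstOrder FirstOrder.Language CategoryTheory

namespace HomPaper

/-- The language consisting of `n` new relation symbols, the `i`-th of arity `k i`. -/
def expLang (n : ℕ) (k : Fin n → ℕ) : FirstOrder.Language.{0, 0} where
  Functions := fun _ => Empty
  Relations := fun m => {i : Fin n // k i = m}

variable (L : FirstOrder.Language.{0, 0})

/-- The interpretation of the new relation symbols: the `i`-th symbol is interpreted
by the set defined by the formula `φ i`. -/
def expStructure (M : Type) [L.Structure M] {n : ℕ} {k : Fin n → ℕ}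
    (φ : ∀ i : Fin n, L.Formula (Fin (k i))) : (expLang n k).Structure M where
  funMap := fun f _ => f.elim
  RelMap := fun {m} r x => (φ r.1).Realize (x ∘ Fin.cast r.2)

/-- `φ` is a family of homogenizing formulas for `M`: the expansion of `M` by new relation
symbols interpreted by the sets defined by the `φ i` is a homogeneous structure. -/
def Homogenizes (M : Type) [L.Structure M] {n : ℕ} {k : Fin n → ℕ}
    (φ : ∀ i : Fin n, L.Formula (Fin (k i))) : Prop :=
  letI : (expLang n k).Structure M := expStructure L M φ
  (L.sum (expLang n k)).IsUltrahomogeneous M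

/-- `M` is homogenizable. -/
def Homogenizable (M : Type) [L.Structure M] : Prop :=
  ∃ (n : ℕ) (k : Fin n → ℕ) (φ : ∀ i : Fin n, L.Formula (Fin (k i))),
    Homogenizes L M φ

/-- A `Σ₁`-formula: an existentially quantified quantifier-free formula. -/
def IsSigma1 {α : Type} (φ : L.Formula α) : Prop :=
  ∃ (m : ℕ) (ψ : L.BoundedFormula α m), ψ.IsQF ∧ φ = ψ.exs

/-- `M` is `Σ₁`-homogenizable: homogenizable with `Σ₁` homogenizing formulas. -/
def Sigma1Homogenizable (M : Type) [L.Structure M] : Prop :=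
  ∃ (n : ℕ) (k : Fin n → ℕ) (φ : ∀ i : Fin n, L.Formula (Fin (k i))),
    (∀ i, IsSigma1 L (φ i)) ∧ Homogenizes L M φ

/-- `M` is unary homogenizable: homogenizable with homogenizing formulas having
exactly one free variable. -/
def UnaryHomogenizable (M : Type) [L.Structure M] : Prop :=
  ∃ (n : ℕ) (φ : ∀ _ : Fin n, L.Formula (Fin 1)),
    Homogenizes L M (k := fun _ => 1) φ

/-- Two tuples have the same complete type over `∅`. -/
def SameType (M : Type) [L.Structure M] {m : ℕ} (a b : Fin m → M) : Prop :=
  ∀ φ : L.Formula (Fin m), φ.Realize a ↔ φ.Realize b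

/-- The complete type of the tuple `a` over `∅` is isolated by a quantifier-free formula. -/
def QFIsolated (M : Type) [L.Structure M] {m : ℕ} (a : Fin m → M) : Prop :=
  ∃ φ : L.Formula (Fin m), φ.IsQF ∧ φ.Realize a ∧
    ∀ b : Fin m → M, φ.Realize b → SameType L M a b

/-- `M` is boundedly homogenizable. -/
def BoundedlyHomogenizable (M : Type) [L.Structure M] : Prop :=
  Homogenizable L M ∧
    ∀ (p : ℕ) (a : Fin p → M), ∃ (q : ℕ) (b : Fin q → M),
      QFIsolated L M (Fin.append a b)

/-- `M` is uniformly homogenizable. -/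
def UniformlyHomogenizable (M : Type) [L.Structure M] : Prop :=
  Homogenizable L M ∧
    ∃ (p : ℕ) (a : Fin p → M), ∀ (q : ℕ) (b : Fin q → M),
      QFIsolated L M (Fin.append a b)

/-- `M` is `k`-unavoidably homogenizable: every complete `n`-type with `n ≥ k` is isolated by
a quantifier-free formula. -/
def KUnavoidablyHomogenizable (M : Type) [L.Structure M] (k : ℕ) : Prop :=
  ∀ n : ℕ, k ≤ n → ∀ a : Fin n → M, QFIsolated L M a

/-- `M` is unavoidably homogenizable. -/
def UnavoidablyHomogenizable (M : Type) [L.Structure M] : Prop :=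
  ∃ k : ℕ, KUnavoidablyHomogenizable L M k

/-- The age of `M`: the class of all finite structures embeddable into `M`
(i.e. all finite substructures of `M`, up to isomorphism). -/
def FinAge (M : Type) [L.Structure M] : Set (Bundled.{0} L.Structure) :=
  {N | Finite N ∧ Nonempty (N ↪[L] M)}

/-- The pair of embeddings `f`, `g` has an amalgam in the class `K`. -/
def HasAmalgam (K : Set (Bundled.{0} L.Structure)) {A B C : Type}
    [L.Structure A] [L.Structure B] [L.Structure C]
    (f : A ↪[L] B) (g : A ↪[L] C) : Prop :=
  ∃ D ∈ K, ∃ (f0 : B ↪[L] D) (g0 : C ↪[L] D), ∀ x : A, f0 (f x) = g0 (g x)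

/-- `A` is an amalgamation base for the class `K`. -/
def IsAmalgamationBase (K : Set (Bundled.{0} L.Structure)) (A : Type) [L.Structure A] : Prop :=
  ∀ B C : Bundled.{0} L.Structure, B ∈ K → C ∈ K →
    ∀ (f : A ↪[L] B) (g : A ↪[L] C), HasAmalgam L K f g

/-- The class `K` satisfies `SEAP_{k,m}`. -/
def SEAPAt (K : Set (Bundled.{0} L.Structure)) (k m : ℕ) : Prop :=
  ∀ A B C : Bundled.{0} L.Structure, A ∈ K → B ∈ K → C ∈ K →
    ∀ (f : A ↪[L] B) (g : A ↪[L] C), ¬ HasAmalgam L K f g →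
      ∃ A0 : L.Substructure A, Nat.card A0 < k ∧
      ∃ B0 ∈ K, ∃ C0 ∈ K, ∃ (eB : B ↪[L] B0) (eC : C ↪[L] C0),
        Nat.card B0 - Nat.card B < m ∧ Nat.card C0 - Nat.card C < m ∧
        ¬ HasAmalgam L K ((eB.comp f).comp A0.subtype) ((eC.comp g).comp A0.subtype)

/-- The class `K` satisfies SEAP. -/
def SEAP (K : Set (Bundled.{0} L.Structure)) : Prop :=
  ∃ k m : ℕ, SEAPAt L K k m

/-- `M` is ω-categorical: `Th(M)` has exactly one countable model up to isomorphism. -/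
def OmegaCategorical (M : Type) [L.Structure M] : Prop :=
  ∀ N₁ N₂ : ((L.completeTheory M).ModelType : Type 1),
    Countable N₁ → Countable N₂ → Nonempty (N₁ ≃[L] N₂)

/-- `M` is model-complete: every embedding between models of `Th(M)` is elementary. -/
def ModelComplete (M : Type) [L.Structure M] : Prop :=
  ∀ (N₁ N₂ : ((L.completeTheory M).ModelType : Type 1)) (f : N₁ ↪[L] N₂)
    (p : ℕ) (φ : L.Formula (Fin p)) (x : Fin p → N₁),
    φ.Realize (fun i => f (x i)) ↔ φ.Realize x


/-- `M` is ω-saturated: every type over a finite tuple of parameters from `M` which is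
consistent with `Th(M)` (equivalently, finitely realized in `M`) is realized in `M`. -/
def OmegaSaturated (M : Type) [L.Structure M] : Prop :=
  ∀ (p : ℕ) (c : Fin p → M) (S : Set (L.Formula (Fin (p + 1)))),
    (∀ s : Finset (L.Formula (Fin (p + 1))), ↑s ⊆ S →
      ∃ a : M, ∀ φ ∈ s, φ.Realize (Fin.snoc c a)) →
    ∃ a : M, ∀ φ ∈ S, φ.Realize (Fin.snoc c a)

/-- `M` is ω-stable: over every countable parameter set there are at most countably many
complete types. -/
def OmegaStable (M : Type) [L.Structure M] : Prop :=
  ∀ A : Set M, A.Countable →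
    ∀ p : ℕ, Countable ((L[[↥A]].completeTheory M).CompleteType (Fin p))

/-- The complete type of `a` is isolated by a conjunction of (relabelings of) the
homogenizing formulas `φ` and quantifier-free formulas. -/
def IsolatedByHomConj (M : Type) [L.Structure M] {n : ℕ} {k : Fin n → ℕ}
    (φ : ∀ i : Fin n, L.Formula (Fin (k i))) {p : ℕ} (a : Fin p → M) : Prop :=
  ∃ ψ : L.Formula (Fin p), ψ.IsQF ∧
    ∃ ts : List (Σ i : Fin n, Fin (k i) → Fin p),
      (ψ.Realize a ∧ ∀ t ∈ ts, ((φ t.1).relabel t.2).Realize a) ∧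
      ∀ b : Fin p → M,
        (ψ.Realize b ∧ ∀ t ∈ ts, ((φ t.1).relabel t.2).Realize b) → SameType L M a b

/-- `a` and `b` realize the same type over the parameter set `X`. -/
def EqTypeOver (M : Type) [L.Structure M] (X : Set M) (a b : M) : Prop :=
  ∀ (p : ℕ) (c : Fin p → M), Set.range c ⊆ X →
    ∀ φ : L.Formula (Fin (p + 1)), φ.Realize (Fin.snoc c a) ↔ φ.Realize (Fin.snoc c b)

/-- The algebraic closure in `M` is degenerate: `acl(X) = X` for every `X ⊆ M`. -/
def DegenerateAcl (M : Type) [L.Structure M] : Prop :=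
  ∀ (X : Set M) (a : M), {b : M | EqTypeOver L M X a b}.Finite → a ∈ X

/-- The induced structure on a subset of a structure for a relational language. -/
def inducedStructure (M : Type) [L.Structure M] [L.IsRelational] (A : Set M) :
    L.Structure A where
  funMap := fun f _ => isEmptyElim f
  RelMap := fun r x => Structure.RelMap r fun i => (x i : M)

/-- Elements `a` and `b` satisfy the same atomic formulas in one free variable
(the same atomic diagram). -/
def SameAtomic1 (M : Type) [L.Structure M] (a b : M) : Prop :=
  ∀ φ : L.Formula (Fin 1), φ.IsAtomic →
    (φ.Realize (fun _ => a) ↔ φ.Realize (fun _ => b))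

/-- `M` has uniformly homogenizing formulas. -/
def HasUniformlyHomogenizingFormulas (M : Type) [L.Structure M] : Prop :=
  ∃ (n : ℕ) (k m : Fin n → ℕ)
    (ψ : ∀ i : Fin n, L.BoundedFormula (Fin (k i)) (m i)),
    (∀ i, (ψ i).IsQF) ∧ Homogenizes L M (fun i => (ψ i).exs) ∧
    ∀ i, ∃ w : Fin (m i) → M, ∀ y : Fin (k i) → M,
      (∃ w0 : Fin (m i) → M, (ψ i).Realize y w0) → (ψ i).Realize y w

end HomPaper

namespace HomPaper

section PermutationGroups

variable (G : Type) {M : Type} [Group G] [MulAction G M] (r : ℕ)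

/-- `x` and `y` are conjugate over the pointwise stabilizer of `e`. -/
def ConjOver (e : Finset M) (x y : M) : Prop :=
  ∃ g : G, (∀ z ∈ e, g • z = z) ∧ g • x = y

/-- The fibre over `b` of the orbit of the pair `(w₀, b₀)`. -/
def orbitFibre (w₀ : M) (b₀ b : Fin r → M) : Set M :=
  {w | ∃ g : G, g • w = w₀ ∧ ∀ i, g • b i = b₀ i}

/-- There is a full binary tree of height `n`, whose splittings are given by fibres of orbits
on `(r + 1)`-tuples, with all branches realized in `S`. -/
def HasTree : ℕ → Set M → Prop
  | 0, S => S.Nonempty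
  | n + 1, S => ∃ (b : Fin r → M) (w₀ : M) (b₀ : Fin r → M),
      HasTree n (S ∩ orbitFibre G r w₀ b₀ b) ∧ HasTree n (S \ orbitFibre G r w₀ b₀ b)

/-- The orbit of `w` under the pointwise stabilizer of `e`. -/
def orbitOver (e : Finset M) (w : M) : Set M := {x | ConjOver G e w x}

/-- Orbits on finite tuples are determined by the orbits of their `r`-subtuples. -/
def OrbitsDeterminedBy (M : Type) [MulAction G M] (r : ℕ) : Prop :=
  ∀ (ι : Type) [Finite ι] [Nonempty ι] (a b : ι → M),
    (∀ f : Fin r → ι, ∃ g : G, ∀ i, g • a (f i) = b (f i)) → ∃ g : G, ∀ i, g • a i = b i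

/-- There are finitely many orbits on tuples of every finite length. -/
def FinitelyManyOrbits (M : Type) [MulAction G M] : Prop :=
  ∀ (ι : Type) [Finite ι], ∃ R : Set (ι → M), R.Finite ∧
    ∀ a : ι → M, ∃ a' ∈ R, ∃ g : G, ∀ i, g • a i = a' i

/-- Every type of `w` over at most `s` elements of `C` is realized in `C`. -/
def SatisfiedIn (C : Finset M) (s : ℕ) (w : M) : Prop :=
  ∀ d ⊆ C, d.card ≤ s → ∃ z ∈ C, ConjOver G d w z

/-- `C'` is obtained from `C` by successively adding elements whose type over everything
before them is isolated by their type over at most `t` elements of `C`. -/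
inductive IsolatedExtension [DecidableEq M] (t : ℕ) (C : Finset M) : Finset M → Prop
  | refl : IsolatedExtension t C C
  | insert {C' : Finset M} (z : M) (D : Finset M) : IsolatedExtension t C C' →
      D ⊆ C → D.card ≤ t → (∀ x, ConjOver G D z x → ConjOver G C' z x) →
      IsolatedExtension t C (insert z C')

variable {G r}

namespace ConjOver

variable {e e' : Finset M} {x y z : M}

theorem refl (e : Finset M) (x : M) : ConjOver G e x x := ⟨1, by simp, by simp⟩

theorem symm (h : ConjOver G e x y) : ConjOver G e y x := by
  obtain ⟨g, hg, rfl⟩ := h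
  refine ⟨g⁻¹, fun z hz => ?_, by simp⟩
  rw [inv_smul_eq_iff, hg z hz]

theorem trans (h : ConjOver G e x y) (h' : ConjOver G e y z) : ConjOver G e x z := by
  obtain ⟨g, hg, rfl⟩ := h
  obtain ⟨k, hk, rfl⟩ := h'
  exact ⟨k * g, fun z hz => by rw [mul_smul, hg z hz, hk z hz], by rw [mul_smul]⟩

theorem mono (hee : e ⊆ e') (h : ConjOver G e' x y) : ConjOver G e x y := by
  obtain ⟨g, hg, rfl⟩ := h
  exact ⟨g, fun z hz => hg z (hee hz), rfl⟩

end ConjOver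

theorem HasTree.mono {n : ℕ} {S S' : Set M} (hS : S ⊆ S') (h : HasTree G r n S) :
    HasTree G r n S' := by
  induction n generalizing S S' with
  | zero => exact Set.Nonempty.mono hS h
  | succ n ih =>
    obtain ⟨b, w₀, b₀, h₁, h₂⟩ := h
    exact ⟨b, w₀, b₀, ih (Set.inter_subset_inter_left _ hS) h₁,
      ih (Set.sdiff_subset_sdiff_left hS) h₂⟩

theorem HasTree.of_succ {n : ℕ} {S : Set M} (h : HasTree G r (n + 1) S) : HasTree G r n S := by
  obtain ⟨b, w₀, b₀, h₁, -⟩ := h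
  exact h₁.mono Set.inter_subset_left

theorem HasTree.of_le {m n : ℕ} (hmn : m ≤ n) {S : Set M} (h : HasTree G r n S) :
    HasTree G r m S := by
  induction n, hmn using Nat.le_induction with
  | base => exact h
  | succ n _ ih => exact ih h.of_succ

theorem smul_mem_orbitFibre_smul_iff (g : G) (w₀ : M) (b₀ b : Fin r → M) (x : M) :
    g • x ∈ orbitFibre G r w₀ b₀ (fun i => g • b i) ↔ x ∈ orbitFibre G r w₀ b₀ b := by
  constructor
  · rintro ⟨k, h₁, h₂⟩
    exact ⟨k * g, by rw [mul_smul, h₁], fun i => by rw [mul_smul, h₂]⟩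
  · rintro ⟨k, h₁, h₂⟩
    exact ⟨k * g⁻¹, by simp [mul_smul, h₁], fun i => by simp [mul_smul, h₂]⟩

/-- Trees are transported by group elements. -/
theorem HasTree.of_smul {n : ℕ} {S S' : Set M} (g : G) (hS : ∀ x ∈ S, g • x ∈ S')
    (h : HasTree G r n S) : HasTree G r n S' := by
  induction n generalizing S S' with
  | zero =>
    obtain ⟨x, hx⟩ := h
    exact ⟨g • x, hS x hx⟩
  | succ n ih =>
    obtain ⟨b, w₀, b₀, h₁, h₂⟩ := h
    refine ⟨fun i => g • b i, w₀, b₀, ih ?_ h₁, ih ?_ h₂⟩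
    · rintro x ⟨hx, hx'⟩
      exact ⟨hS x hx, (smul_mem_orbitFibre_smul_iff g w₀ b₀ b x).2 hx'⟩
    · rintro x ⟨hx, hx'⟩
      exact ⟨hS x hx, fun h => hx' ((smul_mem_orbitFibre_smul_iff g w₀ b₀ b x).1 h)⟩

theorem self_mem_orbitOver (e : Finset M) (w : M) : w ∈ orbitOver G e w := ConjOver.refl e w

/-- A half graph of length `2 ^ n` yields a tree of height `n`. -/
theorem hasTree_of_halfGraph {N : ℕ} (z : ℕ → M) (b : ℕ → Fin r → M) (w₀ : M) (b₀ : Fin r → M)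
    (hzb : ∀ l < N, ∀ k < N, z l ∈ orbitFibre G r w₀ b₀ (b k) ↔ k < l) (n a : ℕ)
    (ha : a + 2 ^ n ≤ N) (S : Set M) (hS : ∀ l, a ≤ l → l < a + 2 ^ n → z l ∈ S) :
    HasTree G r n S := by
  induction n generalizing a S with
  | zero => exact ⟨z a, hS a le_rfl (by simp)⟩
  | succ n ih =>
    have hpos : 0 < 2 ^ n := by positivity
    rw [pow_succ] at ha hS
    refine ⟨b (a + 2 ^ n - 1), w₀, b₀, ih (a + 2 ^ n) (by omega) _ fun l hl hl' => ⟨?_, ?_⟩,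
      ih a (by omega) _ fun l hl hl' => ⟨?_, ?_⟩⟩
    · exact hS l (by omega) (by omega)
    · exact (hzb l (by omega) _ (by omega)).2 (by omega)
    · exact hS l (by omega) (by omega)
    · intro h
      have := (hzb l (by omega) _ (by omega)).1 h
      omega

/-- Two elements that are not conjugate over a finite set are already separated by an
`r`-tuple from it. -/
theorem exists_tuple_of_not_conjOver (hr : OrbitsDeterminedBy G M r) {E : Finset M}
    (hE : E.Nonempty) {x y : M} (h : ¬ ConjOver G E x y) :
    ∃ b : Fin r → M, (∀ i, b i ∈ E) ∧ ¬ ∃ g : G, g • x = y ∧ ∀ i, g • b i = b i := by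
  by_contra hcon
  push Not at hcon
  apply h
  obtain ⟨x₀, hx₀⟩ := hE
  obtain ⟨g, hg⟩ := hr (Option E) (fun o => o.elim x (fun v => v.1))
    (fun o => o.elim y (fun v => v.1)) (by
      intro f
      obtain ⟨g, hg, hg'⟩ := hcon (fun i => (f i).elim x₀ (fun v => v.1)) (by
        intro i
        rcases f i with _ | v
        · exact hx₀
        · exact v.2)
      refine ⟨g, fun i => ?_⟩
      have := hg' i
      rcases h : f i with _ | v
      · simpa using hg
      · simpa [h] using this)
  exact ⟨g, fun z hz => by simpa using hg (some ⟨z, hz⟩), by simpa using hg none⟩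

/-- If the type of `x` over `D` does not isolate a type over `C`, then it has an extension of
smaller rank. -/
theorem exists_rank_drop [DecidableEq M] (hr : OrbitsDeterminedBy G M r) {C D : Finset M}
    (hDC : D ⊆ C) {x y : M} (hxy : ConjOver G D x y) (hxy' : ¬ ConjOver G C x y) {n : ℕ}
    (hn : ¬ HasTree G r (n + 1) (orbitOver G D x)) :
    ∃ b ⊆ C, b.card ≤ r ∧ ∃ x', ConjOver G D x x' ∧ ¬ HasTree G r n (orbitOver G (D ∪ b) x') := by
  have hC : C.Nonempty := by
    rw [Finset.nonempty_iff_ne_empty]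
    rintro rfl
    rw [Finset.subset_empty] at hDC
    subst hDC
    exact hxy' hxy
  obtain ⟨b, hbC, hb⟩ := exists_tuple_of_not_conjOver hr hC hxy'
  have hsub : ∀ i, b i ∈ D ∪ Finset.univ.image b := fun i =>
    Finset.mem_union_right _ (Finset.mem_image_of_mem _ (Finset.mem_univ i))
  refine ⟨Finset.univ.image b, by
    intro v hv
    obtain ⟨i, -, rfl⟩ := Finset.mem_image.1 hv
    exact hbC i, Finset.card_image_le.trans (by simp), ?_⟩
  by_contra hcon
  push Not at hcon
  refine hn ⟨b, x, b, (hcon x (ConjOver.refl _ _)).mono ?_, (hcon y hxy).mono ?_⟩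
  · intro v hv
    refine ⟨ConjOver.mono Finset.subset_union_left hv, ?_⟩
    obtain ⟨g, hg, hgv⟩ := ConjOver.symm hv
    exact ⟨g, hgv, fun i => hg _ (hsub i)⟩
  · intro v hv
    refine ⟨hxy.trans (ConjOver.mono Finset.subset_union_left hv), ?_⟩
    rintro ⟨k, hk, hk'⟩
    obtain ⟨g, hg, hgv⟩ := hv
    refine hb ⟨g⁻¹ * k⁻¹, ?_, fun i => ?_⟩
    · rw [mul_smul, inv_smul_eq_iff, inv_smul_eq_iff, hgv, hk]
    · rw [mul_smul, inv_smul_eq_iff, inv_smul_eq_iff, hg _ (hsub i), hk' i]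

namespace IsolatedExtension

variable [DecidableEq M] {t : ℕ} {C C' : Finset M}

theorem subset (h : IsolatedExtension G t C C') : C ⊆ C' := by
  induction h with
  | refl => exact Finset.Subset.refl _
  | insert z D _ _ _ _ ih => exact ih.trans (Finset.subset_insert _ _)

/-- The type over `C` of a tuple from an isolated extension is isolated by its type over a
small subset of `C`. -/
theorem exists_base (h : IsolatedExtension G t C C') (y : Finset M) (hy : y ⊆ C') :
    ∃ c ⊆ C, c.card ≤ y.card * (t + 1) ∧ ∀ g : G, (∀ x ∈ c, g • x = x) →
      ∃ k : G, (∀ x ∈ C, k • x = x) ∧ ∀ x ∈ y, k • x = g • x := by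
  induction h generalizing y with
  | refl =>
    exact ⟨y, hy, Nat.le_mul_of_pos_right _ (by omega), fun g hg => ⟨1, by simp, fun x hx => by
      rw [hg x hx, one_smul]⟩⟩
  | @insert C' z D hext hD hDt hiso ih =>
    by_cases hz : z ∈ y
    · obtain ⟨c, hcC, hc, hck⟩ := ih (y.erase z) (by
        intro x hx
        rw [Finset.mem_erase] at hx
        exact (Finset.mem_insert.1 (hy hx.2)).resolve_left hx.1)
      refine ⟨c ∪ D, Finset.union_subset hcC hD, ?_, fun g hg => ?_⟩
      · have h₁ := Finset.card_erase_add_one hz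
        have h₂ := Finset.card_union_le c D
        rw [← h₁]
        nlinarith
      · obtain ⟨k, hk, hk'⟩ := hck g fun x hx => hg x (Finset.mem_union_left _ hx)
        obtain ⟨u, hu, huz⟩ := hiso (k⁻¹ • g • z) ⟨k⁻¹ * g, fun x hx => by
          rw [mul_smul, hg x (Finset.mem_union_right _ hx), inv_smul_eq_iff, hk x (hD hx)],
          mul_smul _ _ _⟩
        refine ⟨k * u, fun x hx => by rw [mul_smul, hu x (hext.subset hx), hk x hx],
          fun x hx => ?_⟩
        by_cases hxz : x = z
        · subst hxz
          rw [mul_smul, huz, smul_inv_smul]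
        · rw [mul_smul, hu x ((Finset.mem_insert.1 (hy hx)).resolve_left hxz),
            hk' x (Finset.mem_erase.2 ⟨hxz, hx⟩)]
    · exact ih y fun x hx => (Finset.mem_insert.1 (hy hx)).resolve_left (by
        rintro rfl
        exact hz hx)

theorem satisfiedIn (h : IsolatedExtension G t C C') {s : ℕ} {w : M}
    (hw : SatisfiedIn G C (s * (t + 1)) w) : SatisfiedIn G C' s w := by
  intro y hy hys
  obtain ⟨c, hcC, hc, hck⟩ := h.exists_base y hy
  obtain ⟨z, hz, g, hg, hgz⟩ := hw c hcC (hc.trans (Nat.mul_le_mul_right _ hys))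
  obtain ⟨k, hk, hk'⟩ := hck g hg
  refine ⟨z, h.subset hz, k⁻¹ * g, fun x hx => ?_, ?_⟩
  · rw [mul_smul, ← hk' x hx, inv_smul_smul]
  · rw [mul_smul, hgz, inv_smul_eq_iff, hk z hz]

end IsolatedExtension

/-- One round of adding realizations: every request is either realized, or replaced by a
request of smaller rank. -/
theorem exists_isolatedExtension [DecidableEq M] (hr : OrbitsDeterminedBy G M r) (n t : ℕ)
    (C : Finset M) (Q : Set (Finset M × M)) (hQ : Q.Finite)
    (hQC : ∀ q ∈ Q, q.1 ⊆ C ∧ q.1.card ≤ t ∧ ¬ HasTree G r (n + 1) (orbitOver G q.1 q.2)) :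
    ∃ C', IsolatedExtension G t C C' ∧ ∀ q ∈ Q, (∃ z ∈ C', ConjOver G q.1 q.2 z) ∨
      ∃ b ⊆ C', b.card ≤ r ∧ ∃ x', ConjOver G q.1 q.2 x' ∧
        ¬ HasTree G r n (orbitOver G (q.1 ∪ b) x') := by
  induction Q, hQ using Set.Finite.induction_on with
  | empty => exact ⟨C, .refl, by simp⟩
  | @insert q Q _ _ ih =>
    obtain ⟨C', hext, hC'⟩ := ih fun q' hq' => hQC q' (Set.mem_insert_of_mem _ hq')
    obtain ⟨hqC, hqt, hqn⟩ := hQC q (Set.mem_insert _ _)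
    by_cases hiso : ∀ x, ConjOver G q.1 q.2 x → ConjOver G C' q.2 x
    · refine ⟨insert q.2 C', .insert q.2 q.1 hext hqC hqt hiso, ?_⟩
      rintro q' (rfl | hq')
      · exact Or.inl ⟨q'.2, Finset.mem_insert_self _ _, ConjOver.refl _ _⟩
      · obtain ⟨z, hz, hz'⟩ | ⟨b, hb, hb'⟩ := hC' q' hq'
        · exact Or.inl ⟨z, Finset.mem_insert_of_mem hz, hz'⟩
        · exact Or.inr ⟨b, hb.trans (Finset.subset_insert _ _), hb'⟩
    · push Not at hiso
      obtain ⟨y, hy, hy'⟩ := hiso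
      refine ⟨C', hext, ?_⟩
      rintro q' (rfl | hq')
      · exact Or.inr (exists_rank_drop hr (hqC.trans hext.subset) hy hy' hqn)
      · exact hC' q' hq'

/-- Realizing finitely many requests without destroying satisfaction. -/
theorem exists_realizing_requests [DecidableEq M] (hr : OrbitsDeterminedBy G M r) (n t : ℕ) :
    ∃ P : ℕ → ℕ, ∀ (C : Finset M) (Q : Set (Finset M × M)), Q.Finite →
      (∀ q ∈ Q, q.1 ⊆ C ∧ q.1.card ≤ t ∧ ¬ HasTree G r n (orbitOver G q.1 q.2)) →
      ∃ C', C ⊆ C' ∧ (∀ w s, SatisfiedIn G C (P s) w → SatisfiedIn G C' s w) ∧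
        ∀ q ∈ Q, ∃ z ∈ C', ConjOver G q.1 q.2 z := by
  induction n generalizing t with
  | zero =>
    refine ⟨id, fun C Q _ hQC => ⟨C, Finset.Subset.refl _, fun _ _ h => h, fun q hq => ?_⟩⟩
    exact absurd ⟨q.2, self_mem_orbitOver _ _⟩ (hQC q hq).2.2
  | succ n ih =>
    obtain ⟨P, hP⟩ := ih (t + r)
    refine ⟨fun s => P s * (t + 1), fun C Q hQ hQC => ?_⟩
    obtain ⟨C₁, hext, hC₁⟩ := exists_isolatedExtension hr n t C Q hQ hQC
    let D : Set (Finset M × M) := {q ∈ Q | ¬ ∃ z ∈ C₁, ConjOver G q.1 q.2 z}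
    have hD : ∀ q : D, ∃ b ⊆ C₁, b.card ≤ r ∧ ∃ x', ConjOver G q.1.1 q.1.2 x' ∧
        ¬ HasTree G r n (orbitOver G (q.1.1 ∪ b) x') := fun q =>
      (hC₁ q.1 q.2.1).resolve_left q.2.2
    choose b hbC hbr x hx hxn using hD
    have : Finite D := (hQ.subset fun q hq => hq.1).to_subtype
    obtain ⟨C', hCC', hsat, hreal⟩ := hP C₁ (Set.range fun q : D => (q.1.1 ∪ b q, x q))
      (Set.finite_range _) (by
        rintro _ ⟨q, rfl⟩
        obtain ⟨h₁, h₂, -⟩ := hQC q.1 q.2.1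
        exact ⟨Finset.union_subset (h₁.trans hext.subset) (hbC q),
          (Finset.card_union_le _ _).trans (Nat.add_le_add h₂ (hbr q)), hxn q⟩)
    refine ⟨C', hext.subset.trans hCC', fun w s hw => hsat w s (hext.satisfiedIn hw),
      fun q hq => ?_⟩
    by_cases hqD : ∃ z ∈ C₁, ConjOver G q.1 q.2 z
    · obtain ⟨z, hz, hz'⟩ := hqD
      exact ⟨z, hCC' hz, hz'⟩
    · obtain ⟨z, hz, hz'⟩ := hreal _ ⟨⟨q, hq, hqD⟩, rfl⟩
      exact ⟨z, hz, (hx ⟨q, hq, hqD⟩).trans (hz'.mono Finset.subset_union_left)⟩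

/-- Finite sets have finitely many types over them. -/
theorem FinitelyManyOrbits.exists_finite_conjOver (hf : FinitelyManyOrbits G M) (d : Finset M) :
    ∃ R : Set M, R.Finite ∧ ∀ w, ∃ x ∈ R, ConjOver G d w x := by
  classical
  obtain ⟨R, hR, hR'⟩ := hf (Option d)
  have key : ∀ a : Option d → M, ∃ y : M, (∃ w, ∃ g : G, (∀ v, ∀ hv : v ∈ d, g • v = a (some ⟨v, hv⟩)) ∧
      g • w = a none) → ∃ g : G, (∀ v, ∀ hv : v ∈ d, g • v = a (some ⟨v, hv⟩)) ∧
      g • y = a none := by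
    intro a
    by_cases h : ∃ w, ∃ g : G, (∀ v, ∀ hv : v ∈ d, g • v = a (some ⟨v, hv⟩)) ∧ g • w = a none
    · obtain ⟨w, hw⟩ := h
      exact ⟨w, fun _ => hw⟩
    · exact ⟨a none, fun h' => absurd h' h⟩
  choose y hy using key
  refine ⟨y '' R, hR.image y, fun w => ?_⟩
  obtain ⟨a, ha, g, hg⟩ := hR' (fun o => o.elim w (fun v => v.1))
  have hgv : ∀ v, ∀ hv : v ∈ d, g • v = a (some ⟨v, hv⟩) := fun v hv => hg (some ⟨v, hv⟩)
  obtain ⟨k, hk, hky⟩ := hy a ⟨w, g, hgv, hg none⟩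
  refine ⟨y a, ⟨a, ha, rfl⟩, k⁻¹ * g, fun v hv => ?_, ?_⟩
  · rw [mul_smul, hgv v hv, inv_smul_eq_iff, hk v hv]
  · rw [mul_smul, show g • w = a none from hg none, inv_smul_eq_iff, hky]

/-- Every finite set can be enlarged so that all types over its small subsets are realized,
without destroying satisfaction. -/
theorem exists_realizing_extension [DecidableEq M] (hr : OrbitsDeterminedBy G M r)
    (hf : FinitelyManyOrbits G M) {h : ℕ} (hh : ¬ HasTree G r h (Set.univ : Set M)) (t : ℕ) :
    ∃ P : ℕ → ℕ, ∀ C : Finset M, ∃ C', C ⊆ C' ∧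
      (∀ w s, SatisfiedIn G C (P s) w → SatisfiedIn G C' s w) ∧
      ∀ d ⊆ C, d.card ≤ t → ∀ w, ∃ z ∈ C', ConjOver G d w z := by
  obtain ⟨P, hP⟩ := exists_realizing_requests hr h t
  refine ⟨P, fun C => ?_⟩
  choose R hR hR' using hf.exists_finite_conjOver
  obtain ⟨C', hCC', hsat, hreal⟩ := hP C
    (⋃ d ∈ {d | d ∈ C.powerset ∧ d.card ≤ t}, (fun x => (d, x)) '' R d)
    (Set.Finite.biUnion ((Finset.finite_toSet C.powerset).subset fun d hd => hd.1)
      fun d _ => (hR d).image _) (by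
      intro q hq
      simp only [Set.mem_iUnion, Set.mem_image] at hq
      obtain ⟨d, ⟨hd, hdt⟩, x, -, rfl⟩ := hq
      exact ⟨Finset.mem_powerset.1 hd, hdt, fun h => hh (h.mono (Set.subset_univ _))⟩)
  refine ⟨C', hCC', hsat, fun d hd hdt w => ?_⟩
  obtain ⟨x, hx, hwx⟩ := hR' d w
  obtain ⟨z, hz, hxz⟩ := hreal (d, x) (by
    simp only [Set.mem_iUnion, Set.mem_image]
    exact ⟨d, ⟨Finset.mem_powerset.2 hd, hdt⟩, x, hx, rfl⟩)
  exact ⟨z, hz, hwx.trans hxz⟩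

end PermutationGroups

section Nonsplitting

variable {G M : Type} [Group G] [MulAction G M] [DecidableEq M] {r : ℕ}

variable (G r) in
/-- The rank of the type of `w` over `e` is at most `m`, and it does not drop below `m` on
adding an `r`-tuple from `B` to `e`. -/
def RankStable (e B : Finset M) (m : ℕ) (w : M) : Prop :=
  ¬ HasTree G r (m + 1) (orbitOver G e w) ∧
    ∀ b : Fin r → M, (∀ i, b i ∈ B) →
      HasTree G r m (orbitOver G (e ∪ Finset.univ.image b) w)

namespace RankStable

variable {e B : Finset M} {m : ℕ} {w : M}

theorem exists_smul_tuple_eq (h : RankStable G r e B m w) {g : G}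
    (hg : ∀ x ∈ e, g • x = x) {b : Fin r → M} (hb : ∀ i, b i ∈ B) (hgb : ∀ i, g • b i ∈ B) :
    ∃ k : G, k • w = w ∧ ∀ i, k • b i = g • b i := by
  by_contra hcon
  have hsub : ∀ (c : Fin r → M) (i : Fin r), c i ∈ e ∪ Finset.univ.image c := fun c i =>
    Finset.mem_union_right _ (Finset.mem_image_of_mem _ (Finset.mem_univ i))
  refine h.1 ⟨b, w, b, (h.2 b hb).mono ?_,
    (h.2 (fun i => g • b i) hgb).of_smul g⁻¹ ?_⟩
  · intro x hx
    refine ⟨ConjOver.mono Finset.subset_union_left hx, ?_⟩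
    obtain ⟨k, hk, hkx⟩ := ConjOver.symm hx
    exact ⟨k, hkx, fun i => hk _ (hsub b i)⟩
  · rintro x ⟨l, hl, rfl⟩
    refine ⟨⟨g⁻¹ * l, fun z hz => ?_, mul_smul _ _ _⟩, ?_⟩
    · rw [mul_smul, hl z (Finset.mem_union_left _ hz), inv_smul_eq_iff, hg z hz]
    · rintro ⟨k, hk, hkb⟩
      have hl' : ∀ i, l • g • b i = g • b i := fun i => hl _ (hsub (fun i => g • b i) i)
      refine hcon ⟨l⁻¹ * (g * k⁻¹), ?_, fun i => ?_⟩
      · rw [mul_smul, mul_smul, inv_smul_eq_iff, smul_eq_iff_eq_inv_smul, inv_smul_eq_iff, hk]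
      · rw [mul_smul, mul_smul, inv_smul_eq_iff, hl' i, smul_left_cancel_iff, inv_smul_eq_iff,
          hkb i]

/-- A type whose rank is stable does not split. -/
theorem exists_smul_eq (h : RankStable G r e B m w) (hr : OrbitsDeterminedBy G M r) {g : G}
    (hg : ∀ x ∈ e, g • x = x) {D : Finset M} (hD : D ⊆ B) (hgD : ∀ x ∈ D, g • x ∈ B) :
    ∃ k : G, k • w = w ∧ ∀ x ∈ D, k • x = g • x := by
  obtain rfl | ⟨x₀, hx₀⟩ := D.eq_empty_or_nonempty
  · exact ⟨1, by simp, by simp⟩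
  obtain ⟨k, hk⟩ := hr (Option D) (fun o => o.elim w (fun v => v.1))
    (fun o => o.elim w (fun v => g • v.1)) (by
      intro f
      have hf : ∀ i, (f i).elim x₀ (fun v => v.1) ∈ D := by
        intro i
        rcases f i with _ | v
        · exact hx₀
        · exact v.2
      obtain ⟨k, hk, hk'⟩ := h.exists_smul_tuple_eq hg
        (b := fun i => (f i).elim x₀ (fun v => v.1)) (fun i => hD (hf i)) fun i => hgD _ (hf i)
      refine ⟨k, fun i => ?_⟩
      have := hk' i
      rcases h : f i with _ | v
      · simpa using hk
      · simpa [h] using this)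
  exact ⟨k, by simpa using hk none, fun x hx => by simpa using hk (some ⟨x, hx⟩)⟩

/-- Successive realizations of a type of stable rank are indiscernible. -/
theorem exists_smul_subsequence_eq (h : RankStable G r e B m w) (hr : OrbitsDeterminedBy G M r)
    (heB : e ⊆ B) {u : ℕ → M} {K : ℕ}
    (hu : ∀ j < K, u j ∈ B ∧ ConjOver G (e ∪ (Finset.range j).image u) w (u j))
    {p : ℕ → ℕ} (hp : StrictMono p) (n : ℕ) (hpn : ∀ i < n, p i < K) :
    ∃ g : G, (∀ x ∈ e, g • x = x) ∧ ∀ i < n, g • u (p i) = u i := by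
  induction n with
  | zero => exact ⟨1, by simp, by simp⟩
  | succ n ih =>
    obtain ⟨g, hge, hgu⟩ := ih fun i hi => hpn i (by omega)
    have hnK : n < K := (hp.id_le n).trans_lt (hpn n (by omega))
    obtain ⟨k, hkw, hk⟩ := h.exists_smul_eq hr hge
      (D := e ∪ (Finset.range n).image fun i => u (p i)) (by
        refine Finset.union_subset heB ?_
        rw [Finset.image_subset_iff]
        exact fun i hi => (hu _ (hpn i (by simp at hi; omega))).1) (by
        intro x hx
        rcases Finset.mem_union.1 hx with hx | hx
        · rw [hge x hx]
          exact heB hx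
        · obtain ⟨i, hi, rfl⟩ := Finset.mem_image.1 hx
          rw [Finset.mem_range] at hi
          simp only [hgu i hi]
          exact (hu i (by omega)).1)
    obtain ⟨g₁, hg₁, hg₁w⟩ := (hu (p n) (hpn n (by omega))).2
    obtain ⟨g₂, hg₂, hg₂w⟩ := (hu n hnK).2
    refine ⟨g₂ * (k * g₁⁻¹), fun x hx => ?_, fun i hi => ?_⟩
    · rw [mul_smul, mul_smul, inv_smul_eq_iff.2 (hg₁ x (Finset.mem_union_left _ hx)).symm,
        hk x (Finset.mem_union_left _ hx), hge x hx, hg₂ x (Finset.mem_union_left _ hx)]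
    · rcases Nat.lt_succ_iff_lt_or_eq.1 hi with hi | rfl
      · have h₁ := hg₁ (u (p i)) (Finset.mem_union_right _
          (Finset.mem_image_of_mem _ (Finset.mem_range.2 (hp hi))))
        have h₂ := hg₂ (u i) (Finset.mem_union_right _
          (Finset.mem_image_of_mem _ (Finset.mem_range.2 hi)))
        rw [mul_smul, mul_smul, inv_smul_eq_iff.2 h₁.symm, hk _ (Finset.mem_union_right _
          (Finset.mem_image.2 ⟨i, Finset.mem_range.2 hi, rfl⟩)), hgu i hi, h₂]
      · rw [mul_smul, mul_smul, inv_smul_eq_iff.2 hg₁w.symm, hkw, hg₂w]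

/-- If an `r`-tuple separates long alternating blocks in a sequence of realizations of a type
of stable rank, then there is a half graph, hence a tree. -/
theorem hasTree_univ (h : RankStable G r e B m w) (hr : OrbitsDeterminedBy G M r)
    (heB : e ⊆ B) {u : ℕ → M} {n : ℕ}
    (hu : ∀ j < 2 * 2 ^ n, u j ∈ B ∧ ConjOver G (e ∪ (Finset.range j).image u) w (u j))
    {β : Fin r → M} (hβ : ∀ j < 2 ^ n, ¬ ∃ g : G, g • w = u j ∧ ∀ i, g • β i = β i)
    (hβ' : ∀ j, 2 ^ n ≤ j → j < 2 * 2 ^ n → ∃ g : G, g • w = u j ∧ ∀ i, g • β i = β i) :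
    HasTree G r n (Set.univ : Set M) := by
  have hmem : ∀ j < 2 * 2 ^ n, u j ∈ orbitFibre G r w β β ↔ 2 ^ n ≤ j := by
    intro j hj
    constructor
    · rintro ⟨g, hg, hg'⟩
      by_contra hlt
      refine hβ j (by omega) ⟨g⁻¹, inv_smul_eq_iff.2 hg.symm, fun i => ?_⟩
      exact inv_smul_eq_iff.2 (hg' i).symm
    · intro hle
      obtain ⟨g, hg, hg'⟩ := hβ' j hle hj
      exact ⟨g⁻¹, inv_smul_eq_iff.2 hg.symm, fun i => inv_smul_eq_iff.2 (hg' i).symm⟩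
  have hg : ∀ k : ℕ, ∃ g : G, (∀ x ∈ e, g • x = x) ∧
      ∀ i < 2 ^ n, g • u (if i ≤ k then i else 2 ^ n + i) = u i := by
    intro k
    refine h.exists_smul_subsequence_eq hr heB hu
      (p := fun i => if i ≤ k then i else 2 ^ n + i) ?_ (2 ^ n) ?_
    · intro i j hij
      have : 0 < 2 ^ n := by positivity
      dsimp only
      split_ifs <;> omega
    · intro i hi
      split_ifs <;> omega
  choose g _ hgu using hg
  refine hasTree_of_halfGraph (N := 2 ^ n) u (fun k i => g k • β i) w β ?_ n 0 (by simp) _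
    fun l _ _ => Set.mem_univ _
  intro l hl k _
  rw [← hgu k l hl, smul_mem_orbitFibre_smul_iff, hmem _ (by split_ifs <;> omega)]
  split_ifs <;> omega

end RankStable

/-- Every finite set can be enlarged so that all types over its small subsets have long
sequences of successive realizations, without destroying satisfaction. -/
theorem exists_sequence_extension (hr : OrbitsDeterminedBy G M r)
    (hf : FinitelyManyOrbits G M) {h : ℕ} (hh : ¬ HasTree G r h (Set.univ : Set M)) (t n : ℕ) :
    ∃ P : ℕ → ℕ, ∀ C : Finset M, ∃ C', C ⊆ C' ∧
      (∀ w s, SatisfiedIn G C (P s) w → SatisfiedIn G C' s w) ∧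
      ∀ e ⊆ C, e.card ≤ t → ∀ w, ∃ z : ℕ → M, ∀ i < n,
        z i ∈ C' ∧ ConjOver G (e ∪ (Finset.range i).image z) w (z i) := by
  induction n with
  | zero =>
    exact ⟨id, fun C => ⟨C, Finset.Subset.refl _, fun _ _ h => h,
      fun _ _ _ w => ⟨fun _ => w, by simp⟩⟩⟩
  | succ n ih =>
    obtain ⟨P₁, hP₁⟩ := ih
    obtain ⟨P₂, hP₂⟩ := exists_realizing_extension hr hf hh (t + n)
    refine ⟨fun s => P₁ (P₂ s), fun C => ?_⟩
    obtain ⟨C₁, hC₁, hsat₁, hreal₁⟩ := hP₁ C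
    obtain ⟨C₂, hC₂, hsat₂, hreal₂⟩ := hP₂ C₁
    refine ⟨C₂, hC₁.trans hC₂, fun w s hw => hsat₂ w s (hsat₁ w _ hw), fun e he het w => ?_⟩
    obtain ⟨z, hz⟩ := hreal₁ e he het w
    obtain ⟨y, hy, hwy⟩ := hreal₂ (e ∪ (Finset.range n).image z) (by
      refine Finset.union_subset (he.trans hC₁) (Finset.image_subset_iff.2 fun i hi => ?_)
      exact (hz i (Finset.mem_range.1 hi)).1) ((Finset.card_union_le _ _).trans
        (Nat.add_le_add het (Finset.card_image_le.trans (by simp)))) w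
    have himage : ∀ i ≤ n, (Finset.range i).image (Function.update z n y) =
        (Finset.range i).image z := fun i hi => Finset.image_congr fun j hj => by
      rw [Function.update_of_ne]
      have : j < i := by simpa using hj
      omega
    refine ⟨Function.update z n y, fun i hi => ?_⟩
    rw [himage i (by omega)]
    rcases Nat.lt_succ_iff_lt_or_eq.1 hi with hi | rfl
    · rw [Function.update_of_ne (by omega)]
      exact ⟨hC₂ (hz i hi).1, (hz i hi).2⟩
    · rw [Function.update_self]
      exact ⟨hy, hwy⟩

/-- Every finite set can be enlarged so that all types of stable rank become satisfied, without
destroying satisfaction. -/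
theorem exists_extension_satisfying_rankStable (hr : OrbitsDeterminedBy G M r)
    (hf : FinitelyManyOrbits G M) {h : ℕ} (hh : ¬ HasTree G r h (Set.univ : Set M)) (t s : ℕ) :
    ∃ s₀ : ℕ, ∀ C : Finset M, ∃ C', C ⊆ C' ∧ ∀ w,
      (SatisfiedIn G C s₀ w → SatisfiedIn G C' s w) ∧
      ∀ e ⊆ C, e.card ≤ t → ∀ m, RankStable G r e C' m w → SatisfiedIn G C' s w := by
  obtain ⟨P₂, hP₂⟩ := exists_sequence_extension hr hf hh (t + 2 ^ h + r) (2 ^ h)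
  obtain ⟨P₁, hP₁⟩ := exists_sequence_extension hr hf hh t ((P₂ s + 1) ^ r * 2 ^ h)
  refine ⟨P₁ (P₂ s), fun C => ?_⟩
  obtain ⟨C₁, hC₁, hsat₁, hseq₁⟩ := hP₁ C
  obtain ⟨C₂, hC₂, hsat₂, hseq₂⟩ := hP₂ C₁
  refine ⟨C₂, hC₁.trans hC₂, fun w => ⟨fun hw => hsat₂ w s (hsat₁ w _ hw),
    fun e he het m hw => ?_⟩⟩
  by_cases hσ : SatisfiedIn G C₁ (P₂ s) w
  · exact hsat₂ w s hσ
  exfalso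
  unfold SatisfiedIn at hσ
  push Not at hσ
  obtain ⟨δ, hδ, hδs, hδw⟩ := hσ
  obtain ⟨z, hz⟩ := hseq₁ e he het w
  have hpos : 0 < (P₂ s + 1) ^ r * 2 ^ h := by positivity
  have hδne : δ.Nonempty := by
    rw [Finset.nonempty_iff_ne_empty]
    rintro rfl
    exact hδw (z 0) (hz 0 hpos).1 ((hz 0 hpos).2.mono (Finset.empty_subset _))
  have hβ : ∀ i, ∃ b : Fin r → M, i < (P₂ s + 1) ^ r * 2 ^ h → (∀ j, b j ∈ δ) ∧
      ¬ ∃ g : G, g • w = z i ∧ ∀ j, g • b j = b j := by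
    intro i
    by_cases hi : i < (P₂ s + 1) ^ r * 2 ^ h
    · obtain ⟨b, hb⟩ := exists_tuple_of_not_conjOver hr hδne (hδw (z i) (hz i hi).1)
      exact ⟨b, fun _ => hb⟩
    · exact ⟨fun _ => w, fun h => absurd h hi⟩
  choose b hb using hβ
  obtain ⟨β, hβ, hcard⟩ := Finset.exists_le_card_fiber_of_mul_le_card_of_maps_to
    (s := Finset.range ((P₂ s + 1) ^ r * 2 ^ h)) (t := Fintype.piFinset fun _ : Fin r => δ)
    (f := b) (n := 2 ^ h)
    (fun i hi => Fintype.mem_piFinset.2 (hb i (Finset.mem_range.1 hi)).1)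
    (Fintype.piFinset_nonempty.2 fun _ => hδne) (by
      rw [Fintype.card_piFinset_const, Finset.card_range]
      exact Nat.mul_le_mul_right _ (Nat.pow_le_pow_left (by omega) _))
  rw [Fintype.mem_piFinset] at hβ
  set F := Finset.filter (fun i => b i = β) (Finset.range ((P₂ s + 1) ^ r * 2 ^ h)) with hF
  let q := F.orderEmbOfCardLe hcard
  have hq : ∀ i, q i < (P₂ s + 1) ^ r * 2 ^ h ∧ b (q i) = β := fun i => by
    simpa [hF] using F.orderEmbOfCardLe_mem hcard i
  obtain ⟨y, hy⟩ := hseq₂ (e ∪ Finset.univ.image (fun i => z (q i)) ∪ Finset.univ.image β) (by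
      refine Finset.union_subset (Finset.union_subset (he.trans hC₁) ?_) ?_
      · exact Finset.image_subset_iff.2 fun i _ => (hz _ (hq i).1).1
      · exact Finset.image_subset_iff.2 fun i _ => hδ (hβ i)) (by
      refine (Finset.card_union_le _ _).trans (Nat.add_le_add
        ((Finset.card_union_le _ _).trans (Nat.add_le_add het ?_)) ?_)
      · exact Finset.card_image_le.trans (by simp)
      · exact Finset.card_image_le.trans (by simp)) w
  let u : ℕ → M := fun i => if hi : i < 2 ^ h then z (q ⟨i, hi⟩) else y (i - 2 ^ h)
  have hu₁ : ∀ i (hi : i < 2 ^ h), u i = z (q ⟨i, hi⟩) := fun i hi => dif_pos hi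
  have hu₂ : ∀ i, ¬ i < 2 ^ h → u i = y (i - 2 ^ h) := fun i hi => dif_neg hi
  refine hh (hw.hasTree_univ hr (he.trans (hC₁.trans hC₂)) (u := u) (β := β) ?_ ?_ ?_)
  · intro j hj
    by_cases hj' : j < 2 ^ h
    · obtain ⟨h₁, h₂⟩ := hz _ (hq ⟨j, hj'⟩).1
      rw [hu₁ j hj']
      refine ⟨hC₂ h₁, h₂.mono (Finset.union_subset_union_right
        (Finset.image_subset_iff.2 fun i hi => ?_))⟩
      rw [Finset.mem_range] at hi
      rw [hu₁ i (hi.trans hj')]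
      exact Finset.mem_image_of_mem _ (Finset.mem_range.2 (q.strictMono hi))
    · obtain ⟨h₁, h₂⟩ := hy (j - 2 ^ h) (by omega)
      rw [hu₂ j hj']
      refine ⟨h₁, h₂.mono (Finset.union_subset (fun x hx => by simp [hx])
        (Finset.image_subset_iff.2 fun i hi => ?_))⟩
      rw [Finset.mem_range] at hi
      by_cases hi' : i < 2 ^ h
      · rw [hu₁ i hi']
        refine Finset.mem_union_left _ (Finset.mem_union_left _ (Finset.mem_union_right _ ?_))
        exact Finset.mem_image.2 ⟨⟨i, hi'⟩, Finset.mem_univ _, rfl⟩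
      · rw [hu₂ i hi']
        exact Finset.mem_union_right _
          (Finset.mem_image_of_mem _ (Finset.mem_range.2 (by omega)))
  · intro j hj
    rw [hu₁ j hj, ← (hq ⟨j, hj⟩).2]
    exact (hb _ (hq ⟨j, hj⟩).1).2
  · intro j hj hj'
    rw [hu₂ j (by omega)]
    obtain ⟨g, hg, hgw⟩ := (hy (j - 2 ^ h) (by omega)).2
    exact ⟨g, hgw, fun i => hg _ (Finset.mem_union_left _ (Finset.mem_union_right _
      (Finset.mem_image_of_mem _ (Finset.mem_univ i))))⟩

theorem exists_extension_satisfying_rank (hr : OrbitsDeterminedBy G M r)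
    (hf : FinitelyManyOrbits G M) {h : ℕ} (hh : ¬ HasTree G r h (Set.univ : Set M)) (n t s : ℕ) :
    ∃ s₀ : ℕ, ∀ C : Finset M, ∃ C', C ⊆ C' ∧ ∀ w,
      (SatisfiedIn G C s₀ w ∨ ∃ e ⊆ C, e.card ≤ t ∧ ¬ HasTree G r n (orbitOver G e w)) →
        SatisfiedIn G C' s w := by
  induction n generalizing t s with
  | zero =>
    refine ⟨s, fun C => ⟨C, Finset.Subset.refl _, fun w hw => hw.resolve_right ?_⟩⟩
    rintro ⟨e, -, -, he⟩
    exact he ⟨w, self_mem_orbitOver _ _⟩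
  | succ n ih =>
    obtain ⟨s₁, hs₁⟩ := ih (t + r) s
    obtain ⟨s₀, hs₀⟩ := exists_extension_satisfying_rankStable hr hf hh t s₁
    refine ⟨s₀, fun C => ?_⟩
    obtain ⟨C₁, hC₁, hsat₁⟩ := hs₀ C
    obtain ⟨C₂, hC₂, hsat₂⟩ := hs₁ C₁
    refine ⟨C₂, hC₁.trans hC₂, fun w hw => hsat₂ w ?_⟩
    rcases hw with hw | ⟨e, he, het, hen⟩
    · exact Or.inl ((hsat₁ w).1 hw)
    by_cases hst : RankStable G r e C₁ n w
    · exact Or.inl ((hsat₁ w).2 e he het n hst)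
    · unfold RankStable at hst
      push Not at hst
      obtain ⟨b, hb, hbn⟩ := hst hen
      refine Or.inr ⟨e ∪ Finset.univ.image b, Finset.union_subset (he.trans hC₁)
        (Finset.image_subset_iff.2 fun i _ => hb i), ?_, hbn⟩
      exact (Finset.card_union_le _ _).trans
        (Nat.add_le_add het (Finset.card_image_le.trans (by simp)))

/-- Every finite set is contained in a finite set realizing all types over its small subsets. -/
theorem exists_finset_satisfiedIn (hr : OrbitsDeterminedBy G M r)
    (hf : FinitelyManyOrbits G M) {h : ℕ} (hh : ¬ HasTree G r h (Set.univ : Set M)) (s : ℕ)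
    (C : Finset M) : ∃ C', C ⊆ C' ∧ ∀ w, SatisfiedIn G C' s w := by
  obtain ⟨s₀, hs₀⟩ := exists_extension_satisfying_rank hr hf hh h 0 s
  obtain ⟨C', hCC', hC'⟩ := hs₀ C
  refine ⟨C', hCC', fun w => hC' w (Or.inr ⟨∅, Finset.empty_subset _, by simp, fun hw => ?_⟩)⟩
  exact hh (hw.mono (Set.subset_univ _))

theorem exists_smul_mem_of_satisfiedIn {s : ℕ} {B : Finset M}
    (hB : ∀ w, SatisfiedIn G B s w) {D : Finset M} (hD : D ⊆ B) (U : Finset M)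
    (hs : D.card + U.card ≤ s) : ∃ g : G, (∀ x ∈ D, g • x = x) ∧ ∀ x ∈ U, g • x ∈ B := by
  induction U using Finset.induction_on with
  | empty => exact ⟨1, by simp, by simp⟩
  | @insert a U ha ih =>
    rw [Finset.card_insert_of_notMem ha] at hs
    obtain ⟨g, hgD, hgU⟩ := ih (by omega)
    obtain ⟨z, hz, k, hk, hkz⟩ := hB (g • a) (D ∪ U.image (g • ·))
      (Finset.union_subset hD (Finset.image_subset_iff.2 hgU))
      ((Finset.card_union_le _ _).trans ((Nat.add_le_add_left Finset.card_image_le _).trans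
        (by omega)))
    refine ⟨k * g, fun x hx => ?_, fun x hx => ?_⟩
    · rw [mul_smul, hgD x hx, hk x (Finset.mem_union_left _ hx)]
    · rcases Finset.mem_insert.1 hx with rfl | hx
      · rw [mul_smul, hkz]
        exact hz
      · rw [mul_smul, hk _ (Finset.mem_union_right _ (Finset.mem_image_of_mem _ hx))]
        exact hgU x hx

end Nonsplitting

section Automorphisms

variable (L : FirstOrder.Language.{0, 0}) (M : Type) [L.Structure M]

/-- The automorphism group of a structure for a relational language. -/
def autGroup : Subgroup (Equiv.Perm M) where
  carrier := {g | ∀ (n : ℕ) (R : L.Relations n) (x : Fin n → M),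
    Structure.RelMap R (g ∘ x) ↔ Structure.RelMap R x}
  mul_mem' := by
    intro g k hg hk n R x
    rw [← hk n R x, ← hg n R (k ∘ x)]
    rfl
  one_mem' := fun _ _ _ => Iff.rfl
  inv_mem' := by
    intro g hg n R x
    rw [← hg n R]
    simp [Function.comp_def]

/-- The formulas `χ j` generate all types: finite tuples on which they agree are conjugate under
automorphisms. -/
def Generates {J : Type} {k : J → ℕ} (χ : ∀ j, L.Formula (Fin (k j))) : Prop :=
  ∀ (ι : Type) [Finite ι] (a b : ι → M),
    (∀ j (f : Fin (k j) → ι), (χ j).Realize (a ∘ f) ↔ (χ j).Realize (b ∘ f)) →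
      ∃ g : autGroup L M, ∀ i, g • a i = b i

variable {L M}

theorem realize_smul_iff [L.IsRelational] (g : autGroup L M) {α : Type} (φ : L.Formula α)
    (v : α → M) : φ.Realize (fun i => g • v i) ↔ φ.Realize v :=
  StrongHomClass.realize_formula (F := M ≃[L] M)
    { toEquiv := g.1
      map_fun' := fun f => isEmptyElim f
      map_rel' := fun R x => g.2 _ R x } φ

theorem realize_iff_of_smul_eq [L.IsRelational] {α : Type} {v v' : α → M}
    (h : ∃ g : autGroup L M, ∀ i, g • v i = v' i) (φ : L.Formula α) :
    φ.Realize v ↔ φ.Realize v' := by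
  obtain ⟨g, hg⟩ := h
  rw [← realize_smul_iff g φ v]
  simp only [hg]

instance {n : ℕ} {k : Fin n → ℕ} : (expLang n k).IsRelational :=
  fun _ => inferInstanceAs (IsEmpty Empty)

/-- Tuples with the same diagram in a homogeneous expansion are conjugate. -/
theorem Homogenizes.exists_smul_eq [L.IsRelational] {n : ℕ} {k : Fin n → ℕ}
    {φ : ∀ i : Fin n, L.Formula (Fin (k i))} (hφ : Homogenizes L M φ) {ι : Type} [Finite ι]
    (a b : ι → M) (heq : ∀ i j, a i = a j ↔ b i = b j)
    (hrel : ∀ (m : ℕ) (R : L.Relations m) (f : Fin m → ι),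
      Structure.RelMap R (a ∘ f) ↔ Structure.RelMap R (b ∘ f))
    (hform : ∀ i (f : Fin (k i) → ι), (φ i).Realize (a ∘ f) ↔ (φ i).Realize (b ∘ f)) :
    ∃ g : autGroup L M, ∀ i, g • a i = b i := by
  let _ : (expLang n k).Structure M := expStructure L M φ
  let S := Substructure.closure (L.sum (expLang n k)) (Set.range a)
  have hS : ∀ x : S, ∃ i, a i = x := fun x => by
    simpa using (Substructure.mem_closure_iff_of_isRelational _ _ _).1 x.2
  choose d hd using hS
  have hda : ∀ {m : ℕ} (x : Fin m → S), a ∘ (d ∘ x) = fun i => (x i : M) := fun x =>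
    funext fun i => hd (x i)
  let F : S ↪[L.sum (expLang n k)] M :=
    { toFun := fun x => b (d x)
      inj' := fun x y hxy => Subtype.ext (by
        rw [← hd x, ← hd y]
        exact (heq _ _).2 hxy)
      map_fun' := fun f => isEmptyElim f
      map_rel' := by
        rintro m (R | ⟨i, rfl⟩) x
        · refine (hrel m R (d ∘ x)).symm.trans ?_
          rw [hda]
          rfl
        · refine (hform i (d ∘ x)).symm.trans ?_
          rw [hda]
          rfl }
  obtain ⟨g, hg⟩ := hφ S (Substructure.fg_closure (Set.finite_range a)) F
  refine ⟨⟨g.toEquiv, fun m R x => g.map_rel (Sum.inl R) x⟩, fun i => ?_⟩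
  have hi : a i ∈ S := Substructure.subset_closure ⟨i, rfl⟩
  have h := DFunLike.congr_fun hg ⟨a i, hi⟩
  exact h.symm.trans ((heq _ _).1 (hd ⟨a i, hi⟩))

theorem Homogenizable.exists_generates [L.IsRelational] [Finite (Σ n : ℕ, L.Relations n)]
    (hM : Homogenizable L M) : ∃ (J : Type) (_ : Finite J) (k : J → ℕ)
      (χ : ∀ j, L.Formula (Fin (k j))), Generates L M χ := by
  obtain ⟨n, k, φ, hφ⟩ := hM
  refine ⟨Option ((Σ n : ℕ, L.Relations n) ⊕ Fin n), inferInstance,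
    fun j => j.elim 2 (Sum.elim (fun R => R.1) k), fun j => match j with
      | none => (Term.var (0 : Fin 2)).equal (Term.var (1 : Fin 2))
      | some (Sum.inl R) => R.2.formula Term.var
      | some (Sum.inr i) => φ i, ?_⟩
  intro ι _ a b hab
  refine hφ.exists_smul_eq a b (fun i j => ?_) (fun m R f => ?_) fun i f => ?_
  · have := hab none ![i, j]
    simpa [Formula.realize_equal, Function.comp_def] using this
  · have := hab (some (Sum.inl ⟨m, R⟩)) f
    simpa [Formula.realize_rel, Function.comp_def] using this
  · exact hab (some (Sum.inr i)) f

namespace Generates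

variable {J : Type} [Finite J] {k : J → ℕ} {χ : ∀ j, L.Formula (Fin (k j))}

theorem exists_orbitsDeterminedBy [L.IsRelational] (hχ : Generates L M χ) :
    ∃ r, OrbitsDeterminedBy (autGroup L M) M r := by
  obtain ⟨r, hr⟩ := (Set.finite_range k).bddAbove
  refine ⟨r, fun ι _ _ a b hab => hχ ι a b fun j f => ?_⟩
  have hj : k j ≤ r := hr ⟨j, rfl⟩
  obtain ⟨g, hg⟩ := hab fun i => if h : i.1 < k j then f ⟨i, h⟩ else Classical.arbitrary ι
  refine realize_iff_of_smul_eq ⟨g, fun i => ?_⟩ _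
  simpa using hg (Fin.castLE hj i)

theorem finitelyManyOrbits (hχ : Generates L M χ) : FinitelyManyOrbits (autGroup L M) M := by
  intro ι _
  let D : (ι → M) → Set (Σ j, Fin (k j) → ι) := fun a => {t | (χ t.1).Realize (a ∘ t.2)}
  have hD : ∀ X : Set.range D, ∃ a, D a = X := fun X => X.2
  choose a ha using hD
  refine ⟨Set.range a, Set.finite_range a, fun c => ⟨_, ⟨⟨D c, c, rfl⟩, rfl⟩, hχ ι _ _ ?_⟩⟩
  intro j f
  exact (Set.ext_iff.1 (ha ⟨D c, c, rfl⟩) ⟨j, f⟩).symm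

theorem exists_formula_realize_iff [L.IsRelational] (hχ : Generates L M χ) {ι : Type} [Finite ι]
    (a : ι → M) : ∃ θ : L.Formula ι, ∀ b : ι → M,
      θ.Realize b ↔ ∃ g : autGroup L M, ∀ i, g • a i = b i := by
  classical
  let F : (Σ j, Fin (k j) → ι) → L.Formula ι := fun t =>
    if (χ t.1).Realize (a ∘ t.2) then (χ t.1).relabel t.2 else ((χ t.1).relabel t.2).not
  refine ⟨Formula.iInf F, fun b => ⟨fun h => ?_, fun h => ?_⟩⟩
  · rw [Formula.realize_iInf] at h
    refine hχ ι a b fun j f => ?_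
    have := h ⟨j, f⟩
    by_cases hj : (χ j).Realize (a ∘ f)
    · simpa [F, hj, Formula.realize_relabel] using this
    · simpa [F, hj, Formula.realize_relabel] using this
  · rw [← realize_iff_of_smul_eq h, Formula.realize_iInf]
    rintro ⟨j, f⟩
    by_cases hj : (χ j).Realize (a ∘ f)
    · simp [F, hj, Formula.realize_relabel]
    · simp [F, hj, Formula.realize_relabel]

end Generates

end Automorphisms

section Stability

variable {G M : Type} [Group G] [MulAction G M] {r : ℕ}

variable (G r) in
/-- `S` is invariant under the pointwise stabilizer of `e` and contains trees of every height. -/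
def IsFat (e : Finset M) (S : Set M) : Prop :=
  (∀ g : G, (∀ x ∈ e, g • x = x) → ∀ x ∈ S, g • x ∈ S) ∧ ∀ n, HasTree G r n S

theorem orbitFibre_congr {w₀ w₁ : M} {b₀ b₁ : Fin r → M} (g : G) (hw : g • w₀ = w₁)
    (hb : ∀ i, g • b₀ i = b₁ i) (b : Fin r → M) :
    orbitFibre G r w₀ b₀ b = orbitFibre G r w₁ b₁ b := by
  ext x
  constructor
  · rintro ⟨k, hk, hkb⟩
    exact ⟨g * k, by rw [mul_smul, hk, hw], fun i => by rw [mul_smul, hkb, hb]⟩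
  · rintro ⟨k, hk, hkb⟩
    exact ⟨g⁻¹ * k, by rw [mul_smul, hk, inv_smul_eq_iff, hw],
      fun i => by rw [mul_smul, hkb, inv_smul_eq_iff, hb]⟩

/-- A fat set splits into two fat sets. -/
theorem IsFat.exists_split [DecidableEq M] (hf : FinitelyManyOrbits G M) {e : Finset M}
    {S : Set M} (hS : IsFat G r e S) : ∃ (b : Fin r → M) (w₀ : M) (b₀ : Fin r → M),
      IsFat G r (e ∪ Finset.univ.image b) (S ∩ orbitFibre G r w₀ b₀ b) ∧
      IsFat G r (e ∪ Finset.univ.image b) (S \ orbitFibre G r w₀ b₀ b) := by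
  choose b w₀ b₀ h₁ h₂ using fun n => hS.2 (n + 1)
  obtain ⟨R₁, hR₁, hR₁'⟩ := hf (e ⊕ Fin r)
  obtain ⟨R₂, hR₂, hR₂'⟩ := hf (Option (Fin r))
  choose F₁ hF₁ g₁ hg₁ using hR₁'
  choose F₂ hF₂ g₂ hg₂ using hR₂'
  have := hR₁.to_subtype
  have := hR₂.to_subtype
  let E : ℕ → (e ⊕ Fin r → M) := fun n => Sum.elim (fun v => v.1) (b n)
  let W : ℕ → (Option (Fin r) → M) := fun n o => o.elim (w₀ n) (b₀ n)
  obtain ⟨c, hc⟩ := Finite.exists_infinite_fiber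
    (fun n => ((⟨F₁ (E n), hF₁ _⟩, ⟨F₂ (W n), hF₂ _⟩) : R₁ × R₂))
  rw [Set.infinite_coe_iff] at hc
  obtain ⟨n₀, hn₀⟩ := hc.nonempty
  have key : ∀ n, ∃ m, n ≤ m ∧ ∃ g : G, (∀ x ∈ e, g • x = x) ∧ (∀ i, g • b m i = b n₀ i) ∧
      ∀ b', orbitFibre G r (w₀ m) (b₀ m) b' = orbitFibre G r (w₀ n₀) (b₀ n₀) b' := by
    intro n
    obtain ⟨m, hm, hnm⟩ := hc.exists_gt n
    have heq := hm.trans hn₀.symm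
    simp only [Prod.mk.injEq, Subtype.mk.injEq] at heq
    have hE : ∀ i, ((g₁ (E n₀))⁻¹ * g₁ (E m)) • E m i = E n₀ i := fun i => by
      rw [mul_smul, hg₁, inv_smul_eq_iff, hg₁, heq.1]
    have hW : ∀ i, ((g₂ (W n₀))⁻¹ * g₂ (W m)) • W m i = W n₀ i := fun i => by
      rw [mul_smul, hg₂, inv_smul_eq_iff, hg₂, heq.2]
    exact ⟨m, hnm.le, _, fun x hx => hE (Sum.inl ⟨x, hx⟩), fun i => hE (Sum.inr i),
      orbitFibre_congr _ (hW none) fun i => hW (some i)⟩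
  have hfix : ∀ g : G, (∀ x ∈ e ∪ Finset.univ.image (b n₀), g • x = x) →
      (∀ x ∈ e, g • x = x) ∧ ∀ x, g • x ∈ orbitFibre G r (w₀ n₀) (b₀ n₀) (b n₀) ↔
        x ∈ orbitFibre G r (w₀ n₀) (b₀ n₀) (b n₀) := by
    intro g hg
    refine ⟨fun x hx => hg x (Finset.mem_union_left _ hx), fun x => ?_⟩
    have hgb : (fun i => g • b n₀ i) = b n₀ := funext fun i => hg _
      (Finset.mem_union_right _ (Finset.mem_image_of_mem _ (Finset.mem_univ i)))
    conv_lhs => rw [← hgb]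
    exact smul_mem_orbitFibre_smul_iff g _ _ _ x
  refine ⟨b n₀, w₀ n₀, b₀ n₀, ⟨fun g hg x hx => ?_, fun n => ?_⟩, fun g hg x hx => ?_,
    fun n => ?_⟩
  · exact ⟨hS.1 g (hfix g hg).1 x hx.1, ((hfix g hg).2 x).2 hx.2⟩
  · obtain ⟨m, hnm, g, hge, hgb, horb⟩ := key n
    refine ((h₁ m).of_le hnm).of_smul g fun x hx => ⟨hS.1 g hge x hx.1, ?_⟩
    rw [← horb, ← funext hgb, smul_mem_orbitFibre_smul_iff]
    exact hx.2
  · exact ⟨hS.1 g (hfix g hg).1 x hx.1, fun h => hx.2 (((hfix g hg).2 x).1 h)⟩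
  · obtain ⟨m, hnm, g, hge, hgb, horb⟩ := key n
    refine ((h₂ m).of_le hnm).of_smul g fun x hx => ⟨hS.1 g hge x hx.1, fun h => hx.2 ?_⟩
    rwa [← horb, ← funext hgb, smul_mem_orbitFibre_smul_iff] at h

/-- The initial segment of length `n` of a branch, in reverse order. -/
def branchPrefix (f : ℕ → Bool) : ℕ → List Bool
  | 0 => []
  | n + 1 => f n :: branchPrefix f n

/-- If there are trees of every height, then there is an infinite one. -/
theorem exists_infinite_tree (hf : FinitelyManyOrbits G M)
    (hS : ∀ n, HasTree G r n (Set.univ : Set M)) :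
    ∃ (b : List Bool → Fin r → M) (w₀ : List Bool → M) (b₀ : List Bool → Fin r → M)
      (S : List Bool → Set M), (∀ l, (S l).Nonempty) ∧
      (∀ l, S (true :: l) = S l ∩ orbitFibre G r (w₀ l) (b₀ l) (b l)) ∧
      ∀ l, S (false :: l) = S l \ orbitFibre G r (w₀ l) (b₀ l) (b l) := by
  classical
  let σ := {x : Finset M × Set M // IsFat G r x.1 x.2}
  choose b w₀ b₀ h₁ h₂ using fun x : σ => x.2.exists_split hf
  let child : Bool → σ → σ := fun c x => match c with
    | true => ⟨(_, _), h₁ x⟩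
    | false => ⟨(_, _), h₂ x⟩
  let node : List Bool → σ :=
    List.foldr child ⟨(∅, Set.univ), fun _ _ _ _ => Set.mem_univ _, hS⟩
  exact ⟨fun l => b (node l), fun l => w₀ (node l), fun l => b₀ (node l),
    fun l => (node l).1.2, fun l => ((node l).2.2 0), fun _ => rfl, fun _ => rfl⟩

/-- A sequence of complete types accumulates somewhere. -/
theorem exists_limit_completeType {L : FirstOrder.Language.{0, 0}} {T : L.Theory} {α : Type}
    (q : ℕ → T.CompleteType α) :
    ∃ p : T.CompleteType α, ∀ φ, (∀ᶠ n in Filter.atTop, φ ∈ q n) → φ ∈ p := by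
  let U : Ultrafilter ℕ := Filter.hyperfilter ℕ
  have hU : (U : Filter ℕ) ≤ Filter.atTop := Nat.hyperfilter_le_atTop
  refine ⟨⟨{φ | ∀ᶠ n in (U : Filter ℕ), φ ∈ q n}, fun φ hφ => ?_, ?_, fun φ => ?_⟩,
    fun φ hφ => hU hφ⟩
  · exact Filter.Eventually.of_forall fun n => (q n).subset hφ
  · rw [Theory.isSatisfiable_iff_isFinitelySatisfiable]
    intro T₀ hT₀
    have : ∀ᶠ n in (U : Filter ℕ), ∀ φ ∈ T₀, φ ∈ q n :=
      (Filter.eventually_all_finset T₀).2 hT₀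
    obtain ⟨n, hn⟩ := this.exists
    exact (q n).isMaximal.1.mono hn
  · by_cases h : ∀ᶠ n in (U : Filter ℕ), φ ∈ q n
    · exact Or.inl h
    · rw [← Ultrafilter.eventually_not] at h
      refine Or.inr (h.mono fun n hn => ((q n).mem_or_not_mem φ).resolve_left hn)

/-- Specializing all variables but one of a formula to parameters from `A`. -/
theorem exists_formula_withConstants {L : FirstOrder.Language.{0, 0}} [L.Structure M] {A : Set M}
    (θ : L.Formula (Option (Fin r))) {b : Fin r → M} (hb : ∀ i, b i ∈ A) :
    ∃ φ : L[[A]].Formula (Fin 1), ∀ x : M,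
      φ.Realize (fun _ => x) ↔ θ.Realize fun o => o.elim x b := by
  refine ⟨BoundedFormula.subst ((L.lhomWithConstants A).onFormula θ)
    fun o => o.elim (Term.var 0) fun i => (L.con (⟨b i, hb i⟩ : A)).term, fun x => ?_⟩
  rw [Formula.Realize, BoundedFormula.realize_subst, ← Formula.Realize, LHom.realize_onFormula]
  refine iff_of_eq (congrArg _ (funext fun o => ?_))
  rcases o with _ | i
  · rfl
  · simp

theorem Generates.exists_not_hasTree {L : FirstOrder.Language.{0, 0}} [L.IsRelational]
    [L.Structure M] (hst : OmegaStable L M) {J : Type} [Finite J] {k : J → ℕ}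
    {χ : ∀ j, L.Formula (Fin (k j))} (hχ : Generates L M χ) (r : ℕ) :
    ∃ h, ¬ HasTree (autGroup L M) r h (Set.univ : Set M) := by
  by_contra! hcon
  obtain ⟨b, w₀, b₀, S, hne, hS₁, hS₂⟩ := exists_infinite_tree hχ.finitelyManyOrbits hcon
  have : Nonempty M := (hne []).to_type
  let A : Set M := ⋃ l, Set.range (b l)
  have hA : A.Countable := Set.countable_iUnion fun l => Set.countable_range _
  have hb : ∀ l i, b l i ∈ A := fun l i => Set.mem_iUnion.2 ⟨l, i, rfl⟩
  have hφ : ∀ l, ∃ φ : L[[A]].Formula (Fin 1), ∀ x : M, φ.Realize (fun _ => x) ↔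
      x ∈ orbitFibre (autGroup L M) r (w₀ l) (b₀ l) (b l) := by
    intro l
    obtain ⟨θ, hθ⟩ := hχ.exists_formula_realize_iff
      (fun o : Option (Fin r) => o.elim (w₀ l) (b₀ l))
    obtain ⟨φ, hφ⟩ := exists_formula_withConstants θ (hb l)
    refine ⟨φ, fun x => ?_⟩
    rw [hφ, hθ]
    constructor
    · rintro ⟨g, hg⟩
      exact ⟨g⁻¹, inv_smul_eq_iff.2 (hg none).symm, fun i => inv_smul_eq_iff.2 (hg (some i)).symm⟩
    · rintro ⟨g, hg, hgb⟩
      refine ⟨g⁻¹, fun o => ?_⟩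
      rcases o with _ | i
      · exact inv_smul_eq_iff.2 hg.symm
      · exact inv_smul_eq_iff.2 (hgb i).symm
  choose φ hφ using hφ
  have hstep : ∀ c l, S (c :: l) ⊆ S l := by
    intro c l
    cases c
    · rw [hS₂]
      exact Set.sdiff_subset
    · rw [hS₁]
      exact Set.inter_subset_left
  have hanti : ∀ f : ℕ → Bool, Antitone fun n => S (branchPrefix f n) := fun f =>
    antitone_nat_of_succ_le fun n => hstep _ _
  choose w hw using hne
  let T := L[[A]].completeTheory M
  have hlim := fun f : ℕ → Bool =>
    exists_limit_completeType fun n => T.typeOf fun _ : Fin 1 => w (branchPrefix f n)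
  choose p hp using hlim
  have hmem : ∀ (f : ℕ → Bool) (n : ℕ),
      Formula.equivSentence (φ (branchPrefix f n)) ∈ p f ↔ f n = true := by
    intro f n
    have hsub : ∀ m, n + 1 ≤ m → w (branchPrefix f m) ∈ S (f n :: branchPrefix f n) :=
      fun m hm => hanti f hm (hw _)
    cases hfn : f n
    · simp only [Bool.false_eq_true, iff_false]
      rw [← Theory.CompleteType.not_mem_iff]
      refine hp f _ (Filter.eventually_atTop.2 ⟨n + 1, fun m hm => ?_⟩)
      rw [Theory.CompleteType.not_mem_iff, Theory.CompleteType.formula_mem_typeOf, hφ]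
      have := hsub m hm
      rw [hfn, hS₂] at this
      exact this.2
    · simp only [iff_true]
      refine hp f _ (Filter.eventually_atTop.2 ⟨n + 1, fun m hm => ?_⟩)
      rw [Theory.CompleteType.formula_mem_typeOf, hφ]
      have := hsub m hm
      rw [hfn, hS₁] at this
      exact this.2
  have hinj : Function.Injective p := by
    intro f f' hff
    have hpre : ∀ n, branchPrefix f n = branchPrefix f' n := by
      intro n
      induction n with
      | zero => rfl
      | succ n ih =>
        have h : f n = true ↔ f' n = true := by rw [← hmem f n, ← hmem f' n, hff, ih]
        simp only [branchPrefix, ih, List.cons.injEq, and_true]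
        exact Bool.eq_iff_iff.2 h
    funext n
    exact (List.cons.inj (hpre (n + 1))).1
  have := hst A hA 1
  have hc : Countable (ℕ → Bool) := hinj.countable
  rw [← Cardinal.mk_le_aleph0_iff] at hc
  refine absurd hc (not_le.2 ?_)
  simpa using Cardinal.cantor Cardinal.aleph0

end Stability

section QuantifierFree

variable {L : FirstOrder.Language.{0, 0}} {M : Type} [L.Structure M]

/-- Finite conjunctions of quantifier-free formulas are quantifier-free. -/
theorem exists_isQF_realize_iff (M : Type) [L.Structure M] {α : Type} {X : Set (L.Formula α)}
    (hX : X.Finite) (hqf : ∀ χ ∈ X, χ.IsQF) :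
    ∃ ψ : L.Formula α, ψ.IsQF ∧ ∀ v : α → M, ψ.Realize v ↔ ∀ χ ∈ X, χ.Realize v := by
  induction X, hX using Set.Finite.induction_on with
  | empty => exact ⟨⊤, BoundedFormula.IsQF.top, fun v => by simp⟩
  | @insert χ X _ _ ih =>
    obtain ⟨ψ, hψ, hψv⟩ := ih fun χ' h => hqf χ' (Set.mem_insert_of_mem _ h)
    refine ⟨χ ⊓ ψ, (hqf χ (Set.mem_insert _ _)).inf hψ, fun v => ?_⟩
    rw [Formula.realize_inf, hψv]
    simp

theorem realize_congr_of_freeVarFinset {α : Type} [DecidableEq α] (φ : L.Formula α)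
    {v v' : α → M} (h : ∀ x ∈ BoundedFormula.freeVarFinset φ, v x = v' x) :
    φ.Realize v ↔ φ.Realize v' :=
  (BoundedFormula.realize_restrictFreeVar (f := Subtype.val) v fun _ => rfl).symm.trans
    (BoundedFormula.realize_restrictFreeVar (f := Subtype.val) v' fun a => h a a.2)

/-- In a model-complete structure, every true formula is implied by a quantifier-free formula
in the diagram of the structure. -/
theorem ModelComplete.exists_isQF [L.IsRelational] [Nonempty M] (hmc : ModelComplete L M) {p : ℕ}
    (θ : L.Formula (Fin p)) (d : Fin p → M) (hd : θ.Realize d) :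
    ∃ ψ : L.Formula M, ψ.IsQF ∧ ψ.Realize id ∧ ∀ v : M → M, ψ.Realize v → θ.Realize (v ∘ d) := by
  by_contra! hcon
  let Δ : Set (L.Formula M) := {χ | χ.IsQF ∧ χ.Realize id}
  let Γ : Set (L.Formula M) := Δ ∪ ({(θ.relabel d).not} ∪ {χ | ∀ v : M → M, χ.Realize v})
  have hsat : Theory.IsSatisfiable (Formula.equivSentence '' Γ : L[[M]].Theory) := by
    rw [Theory.isSatisfiable_iff_isFinitelySatisfiable]
    intro T₀ hT₀
    obtain ⟨ψ, hψ, hψv⟩ := exists_isQF_realize_iff M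
      (X := Δ ∩ Formula.equivSentence ⁻¹' (T₀ : Set L[[M]].Sentence))
      ((T₀.finite_toSet.preimage Formula.equivSentence.injective.injOn).inter_of_right _)
      fun χ hχ => hχ.1.1
    obtain ⟨v, hv, hθv⟩ := hcon ψ hψ ((hψv id).2 fun χ hχ => hχ.1.2)
    let S : L[[M]].Structure M := @withConstantsStructure L M _ M (constantsOn.structure v)
    have : @Theory.Model _ M S (T₀ : L[[M]].Theory) := by
      refine @Theory.Model.mk _ M S _ fun φ hφ => ?_
      obtain ⟨χ, hχ, rfl⟩ := hT₀ hφ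
      rw [← Formula.realize_equivSentence_symm, Equiv.symm_apply_apply]
      rcases hχ with hχ | rfl | hχ
      · exact (hψv v).1 hv χ ⟨hχ, hφ⟩
      · rw [Formula.realize_not, Formula.realize_relabel]
        exact hθv
      · exact hχ v
    exact @Theory.Model.isSatisfiable _ _ M _ S this
  obtain ⟨N⟩ := hsat
  let _ : L.Structure N := (L.lhomWithConstants M).reduct N
  have hN : ∀ χ ∈ Γ, χ.Realize fun x => (L.con x : N) := by
    intro χ hχ
    rw [← Formula.realize_equivSentence]
    exact N.is_model.realize_of_mem _ ⟨χ, hχ, rfl⟩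
  have hmodel : N ⊨ L.completeTheory M := by
    rw [Theory.model_iff]
    intro φ hφ
    have hφ' : Formula.Realize φ (default : Empty → M) := hφ
    have := hN (Formula.relabel Empty.elim φ) (Or.inr (Or.inr fun v => by
      rw [Formula.realize_relabel]
      convert hφ'))
    rw [Formula.realize_relabel] at this
    change Formula.Realize φ (default : Empty → N)
    convert this
  have hdiag : ∀ χ : L.Formula M, χ.IsQF → (χ.Realize (fun x => (L.con x : N)) ↔
      χ.Realize id) := by
    intro χ hχ
    refine ⟨fun h => ?_, fun h => hN χ (Or.inl ⟨hχ, h⟩)⟩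
    by_contra hn
    exact hN χ.not (Or.inl ⟨hχ.not, hn⟩) h
  let f : M ↪[L] N :=
    { toFun := fun x => (L.con x : N)
      inj' := fun x y hxy => by
        have := hdiag ((Term.var x).equal (Term.var y))
          (BoundedFormula.IsAtomic.equal _ _).isQF
        simpa [Formula.realize_equal, show (L.con x : N) = L.con y from hxy] using this
      map_fun' := fun f => isEmptyElim f
      map_rel' := fun R x => by
        have := hdiag (R.formula fun i => Term.var (x i)) (BoundedFormula.IsAtomic.rel _ _).isQF
        simpa [Formula.realize_rel, Function.comp_def] using this }
  have h := (hmc (Theory.ModelType.of _ M) (Theory.ModelType.of _ N) f p θ d).2 hd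
  have h' := hN _ (Or.inr (Or.inl rfl))
  rw [Formula.realize_not, Formula.realize_relabel] at h'
  exact h' h

end QuantifierFree

section Main

open Finset

/-- If every element is satisfied in a finite set, for large enough subsets, then the type of
every tuple enumerating that set is isolated by a quantifier-free formula. -/
theorem qfIsolated_of_satisfiedIn {L : FirstOrder.Language.{0, 0}} [L.IsRelational]
    {M : Type} [L.Structure M] [DecidableEq M] {r s n : ℕ}
    (hr : OrbitsDeterminedBy (autGroup L M) M r) {R : Set (Fin r → M)}
    (hR : ∀ d : Fin r → M, ∃ d₀ ∈ R, ∃ g : autGroup L M, ∀ i, g • d i = d₀ i)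
    {ψ : (Fin r → M) → L.Formula M} (hψ : ∀ d, (ψ d).IsQF) (hψid : ∀ d, (ψ d).Realize id)
    (hψc : ∀ (d : Fin r → M) (v : M → M), (ψ d).Realize v →
      ∃ g : autGroup L M, ∀ i, g • d i = v (d i))
    (hs : ∀ d ∈ R, r + (BoundedFormula.freeVarFinset (ψ d)).card ≤ s) {B : Finset M}
    (hB : ∀ w, SatisfiedIn (autGroup L M) B s w) (c : Fin n → M) (hc : ∀ x, x ∈ B ↔ ∃ j, c j = x)
    [Nonempty (Fin n)] : QFIsolated L M c := by
  have hidx : ∀ x, ∃ j, x ∈ B → c j = x := fun x => by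
    by_cases hx : x ∈ B
    · exact ((hc x).1 hx).imp fun j hj _ => hj
    · exact ⟨Classical.arbitrary _, fun h => absurd h hx⟩
  choose idx hidx using hidx
  have hcB : ∀ j, c j ∈ B := fun j => (hc _).2 ⟨j, rfl⟩
  have key : ∀ f : Fin r → Fin n, ∃ d₀ : Fin r → M, ∃ g : autGroup L M,
      (∀ i, g • d₀ i = c (f i)) ∧
      ∀ x ∈ BoundedFormula.freeVarFinset (ψ d₀), g • x ∈ B := by
    intro f
    obtain ⟨d₀, hd₀, g₀, hg₀⟩ := hR fun i => c (f i)
    obtain ⟨g₁, hg₁, hg₁B⟩ := exists_smul_mem_of_satisfiedIn hB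
      (D := univ.image fun i => c (f i)) (by
        intro x hx
        obtain ⟨i, -, rfl⟩ := mem_image.1 hx
        exact hcB _)
      ((BoundedFormula.freeVarFinset (ψ d₀)).image fun x => g₀⁻¹ • x)
      ((add_le_add (card_image_le.trans (by simp)) card_image_le).trans (hs d₀ hd₀))
    refine ⟨d₀, g₁ * g₀⁻¹, fun i => ?_, fun x hx => ?_⟩
    · rw [mul_smul, ← hg₀ i, inv_smul_smul]
      exact hg₁ _ (mem_image_of_mem _ (mem_univ i))
    · rw [mul_smul]
      exact hg₁B _ (mem_image_of_mem _ hx)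
  choose d₀ g hg hgB using key
  obtain ⟨φ, hφ, hφv⟩ := exists_isQF_realize_iff M
    (X := Set.range (fun f => (ψ (d₀ f)).relabel fun x => idx (g f • x)) ∪
      Set.range fun j => (Term.var (idx (c j)) : L.Term (Fin n)).equal (Term.var j))
    ((Set.finite_range _).union (Set.finite_range _)) (by
      rintro χ (⟨f, rfl⟩ | ⟨j, rfl⟩)
      · exact (hψ _).relabel _
      · exact (BoundedFormula.IsAtomic.equal _ _).isQF)
  refine ⟨φ, hφ, (hφv c).2 ?_, fun c' hc' => ?_⟩
  · rintro χ (⟨f, rfl⟩ | ⟨j, rfl⟩)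
    · refine Formula.realize_relabel.2 ((realize_congr_of_freeVarFinset (ψ (d₀ f))
        (v' := fun x => g f • x) fun x hx => hidx _ (hgB f x hx)).2 ?_)
      exact (realize_smul_iff (g f) (ψ (d₀ f)) id).2 (hψid _)
    · rw [Formula.realize_equal]
      exact hidx _ (hcB j)
  · rw [hφv] at hc'
    refine fun θ => realize_iff_of_smul_eq (hr (Fin n) c c' fun f => ?_) θ
    obtain ⟨k, hk⟩ := hψc (d₀ f) _ (Formula.realize_relabel.1 (hc' _ (Or.inl ⟨f, rfl⟩)))
    refine ⟨k * (g f)⁻¹, fun i => ?_⟩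
    rw [← hg f i, mul_smul, inv_smul_smul, hk i, Function.comp_apply, hg f i]
    exact Formula.realize_equal.1 (hc' _ (Or.inr ⟨f i, rfl⟩))

end Main

/-- An ω-stable, model-complete, homogenizable structure is boundedly
homogenizable. -/
theorem omegaStable_boundedlyHomogenizable
    (L : FirstOrder.Language.{0, 0}) [L.IsRelational] [Finite (Σ n : ℕ, L.Relations n)]
    (M : Type) [L.Structure M]
    (hst : OmegaStable L M) (hmc : ModelComplete L M) (hhom : Homogenizable L M) :
    BoundedlyHomogenizable L M := by
  refine ⟨hhom, fun p a => ?_⟩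
  classical
  rcases isEmpty_or_nonempty M with hM | ⟨⟨m₀⟩⟩
  · refine ⟨0, Fin.elim0, ⊤, BoundedFormula.IsQF.top, by simp, fun b _ θ => ?_⟩
    rw [Subsingleton.elim b]
  have : Nonempty M := ⟨m₀⟩
  obtain ⟨J, _, k, χ, hχ⟩ := Homogenizable.exists_generates hhom
  obtain ⟨r, hr⟩ := hχ.exists_orbitsDeterminedBy
  obtain ⟨h, hh⟩ := hχ.exists_not_hasTree hst r
  choose θ hθ using fun d : Fin r → M => hχ.exists_formula_realize_iff d
  choose ψ hψ hψid hψθ using fun d : Fin r → M =>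
    hmc.exists_isQF (θ d) d ((hθ d d).2 ⟨1, fun i => one_smul _ _⟩)
  obtain ⟨R, hRfin, hR⟩ := hχ.finitelyManyOrbits (Fin r)
  obtain ⟨s, hs⟩ :=
    (hRfin.image fun d => r + (BoundedFormula.freeVarFinset (ψ d)).card).bddAbove
  obtain ⟨B, haB, hB⟩ := exists_finset_satisfiedIn hr hχ.finitelyManyOrbits hh s
    (insert m₀ (Finset.univ.image a))
  refine ⟨B.card, fun j => B.equivFin.symm j, ?_⟩
  have hcard : 0 < B.card := Finset.card_pos.2 ⟨m₀, haB (Finset.mem_insert_self _ _)⟩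
  have : Nonempty (Fin (p + B.card)) := ⟨⟨0, by omega⟩⟩
  refine qfIsolated_of_satisfiedIn hr hR hψ hψid (fun d v hv => (hθ d _).1 (hψθ d v hv))
    (fun d hd => hs ⟨d, hd, rfl⟩) hB _ fun x => ⟨fun hx => ?_, ?_⟩
  · exact ⟨Fin.natAdd p (B.equivFin ⟨x, hx⟩), by simp⟩
  · rintro ⟨j, rfl⟩
    refine Fin.addCases (fun i => ?_) (fun i => ?_) j
    · rw [Fin.append_left]
      exact haB (Finset.mem_insert_of_mem (Finset.mem_image_of_mem _ (Finset.mem_univ i)))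
    · rw [Fin.append_right]
      exact (B.equivFin.symm i).2

end HomPaper
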